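/- Let N be a normal subgroup of a finite group G, let χ be a complex irreducible character of G and θ an irreducible constituent of the restriction of χ to N. Then θ(1) divides χ(1), and χ(1)/θ(1) divides the index |G:N|. -/

import Mathlib

/-- A representation is irreducible if the space is non-trivial and the only
invariant subspaces are `⊥` and `⊤`. -/
def IsIrreducibleRep {k G V : Type*} [CommSemiring k] [Monoid G]
    [AddCommMonoid V] [Module k V] (ρ : Representation k G V) : Prop :=
  Nontrivial V ∧
    ∀ W : Submodule k V, (∀ (g : G) (v : V), v ∈ W → ρ g v ∈ W) → W = ⊥ ∨ W = ⊤

open Module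

namespace IsIrreducibleRep

/-- **Schur's lemma** for endomorphisms: an operator commuting with an irreducible representation
is a scalar. -/
theorem exists_eq_smul_id {G V : Type*} [Monoid G] [AddCommGroup V] [Module ℂ V]
    [FiniteDimensional ℂ V] {ρ : Representation ℂ G V} (hρ : IsIrreducibleRep ρ)
    (T : V →ₗ[ℂ] V) (hT : ∀ g v, T (ρ g v) = ρ g (T v)) : ∃ c : ℂ, ∀ v, T v = c • v := by
  have := hρ.1
  obtain ⟨c, hc⟩ := Module.End.exists_eigenvalue T
  refine ⟨c, fun v => ?_⟩
  have htop : Module.End.eigenspace T c = ⊤ := by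
    refine (hρ.2 _ fun g v hv => ?_).resolve_left hc
    rw [Module.End.mem_eigenspace_iff] at hv ⊢
    rw [hT, hv, map_smul]
  exact Module.End.mem_eigenspace_iff.1 (htop ▸ Submodule.mem_top)

/-- A nonzero linear map out of an irreducible representation whose kernel is invariant is
injective. -/
theorem injective_of_ker_invariant {k G W V : Type*} [Field k] [Monoid G] [AddCommGroup W]
    [Module k W] [AddCommGroup V] [Module k V] {σ : Representation k G W}
    (hσ : IsIrreducibleRep σ) {f : W →ₗ[k] V} (hf0 : f ≠ 0)
    (hf : ∀ g w, f w = 0 → f (σ g w) = 0) : Function.Injective f := by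
  refine LinearMap.ker_eq_bot.1 ((hσ.2 _ fun g w hw => ?_).resolve_right fun h => hf0 ?_)
  · exact hf g w hw
  · exact LinearMap.ker_eq_top.1 h

variable {G V W : Type*} [Group G] {N : Subgroup G} [AddCommGroup V] [Module ℂ V] [AddCommGroup W]
  [Module ℂ W] {ρ : Representation ℂ G V} {σ : Representation ℂ N W} {f : W →ₗ[ℂ] V}

/-- Averaging a left inverse produces an intertwining map which is a nonzero scalar on a
subrepresentation. -/
theorem exists_equivariant_comp_eq_smul [Finite N] (hσ : IsIrreducibleRep σ) (hf0 : f ≠ 0)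
    (hf : ∀ (n : N) (w : W), f (σ n w) = ρ n (f w)) :
    ∃ (φ : V →ₗ[ℂ] W) (c : ℂ), c ≠ 0 ∧ (∀ (n : N) (v : V), φ (ρ n v) = σ n (φ v)) ∧
      ∀ w, φ (f w) = c • w := by
  classical
  have := Fintype.ofFinite N
  have hinj : Function.Injective f :=
    hσ.injective_of_ker_invariant hf0 fun n w hw => by rw [hf, hw, map_zero]
  obtain ⟨l, hl⟩ := LinearMap.exists_leftInverse_of_injective f (LinearMap.ker_eq_bot.2 hinj)
  refine ⟨∑ n : N, σ n ∘ₗ l ∘ₗ ρ (n⁻¹ : N), Fintype.card N, by simp, fun m v => ?_, fun w => ?_⟩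
  · simp only [LinearMap.sum_apply, LinearMap.comp_apply, map_sum]
    refine (Fintype.sum_equiv (Equiv.mulLeft m) _ _ fun n => ?_).symm
    simp [← Module.End.mul_apply, ← map_mul]
  · have h (n : N) : σ n (l (ρ (n⁻¹ : N) (f w))) = w := by
      rw [← hf, show l (f (σ n⁻¹ w)) = σ n⁻¹ w from LinearMap.congr_fun hl _]
      simp
    simp only [LinearMap.sum_apply, LinearMap.comp_apply, h]
    simp [← Nat.cast_smul_eq_nsmul ℂ]

/-- The degree of an irreducible constituent of the restriction to a normal subgroup divides the
degree of the irreducible representation. -/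
theorem finrank_dvd_finrank [N.Normal] [FiniteDimensional ℂ V]
    [FiniteDimensional ℂ W] (hρ : IsIrreducibleRep ρ) (hσ : IsIrreducibleRep σ)
    (hf0 : f ≠ 0) (hf : ∀ (n : N) (w : W), f (σ n w) = ρ n (f w)) :
    finrank ℂ W ∣ finrank ℂ V := by
  have hinj : Function.Injective f :=
    hσ.injective_of_ker_invariant hf0 fun n w hw => by rw [hf, hw, map_zero]
  have hρinj (g : G) : Function.Injective (ρ g) := fun x y h => by
    simpa using congrArg (ρ g⁻¹) h
  have key (m : ℕ) : ∀ U : Submodule ℂ V, (∀ (n : N) (v : V), v ∈ U → ρ n v ∈ U) →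
      finrank ℂ W ∣ finrank ℂ U → finrank ℂ V - finrank ℂ U = m →
      finrank ℂ W ∣ finrank ℂ V := by
    induction m using Nat.strong_induction_on with
    | _ m ih =>
      intro U hU hd hm
      by_cases hall : ∀ (g : G) (w : W), ρ g (f w) ∈ U
      · have htop : Submodule.span ℂ (Set.range fun p : G × W => ρ p.1 (f p.2)) = ⊤ := by
          refine (hρ.2 _ fun g v hv => ?_).resolve_left fun h => hf0 ?_
          · induction hv using Submodule.span_induction with
            | mem x hx =>
              obtain ⟨⟨k, w⟩, rfl⟩ := hx
              exact Submodule.subset_span ⟨(g * k, w), by simp⟩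
            | zero => simp
            | add x y _ _ hx hy => rw [map_add]; exact add_mem hx hy
            | smul c x _ hx => rw [map_smul]; exact Submodule.smul_mem _ c hx
          · ext w
            have : f w ∈ Submodule.span ℂ (Set.range fun p : G × W => ρ p.1 (f p.2)) :=
              Submodule.subset_span ⟨(1, w), by simp⟩
            simpa [h] using this
        have hUtop : U = ⊤ := top_le_iff.1 <| htop ▸ Submodule.span_le.2 (by
          rintro _ ⟨⟨g, w⟩, rfl⟩
          exact hall g w)
        rwa [hUtop, finrank_top] at hd
      · push Not at hall
        obtain ⟨g, w₀, hw₀⟩ := hall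
        set φ : W →ₗ[ℂ] V := ρ g ∘ₗ f with hφ
        have hφN (n : N) (w : W) : ρ n (φ w) = φ (σ (MulAut.conjNormal g⁻¹ n) w) := by
          simp only [hφ, LinearMap.comp_apply, hf, ← Module.End.mul_apply, ← map_mul]
          congr 2
          simp [mul_assoc]
        have hφN' (n : N) (w : W) : φ (σ n w) = ρ (MulAut.conjNormal g n : N) (φ w) := by
          rw [hφN, ← MulAut.mul_apply, ← map_mul]
          simp
        have hcomap : U.comap φ = ⊥ := by
          refine (hσ.2 _ fun n w hw => ?_).resolve_right fun h => hw₀ ?_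
          · rw [Submodule.mem_comap] at hw ⊢
            rw [hφN']
            exact hU _ _ hw
          · exact (h ▸ Submodule.mem_top : w₀ ∈ U.comap φ)
        have hinf : U ⊓ LinearMap.range φ = ⊥ := by
          rw [eq_bot_iff]
          rintro _ ⟨hx, w, rfl⟩
          have : w ∈ U.comap φ := hx
          rw [hcomap, Submodule.mem_bot] at this
          simp [this]
        have hdim := Submodule.finrank_sup_add_finrank_inf_eq U (LinearMap.range φ)
        rw [hinf, finrank_bot, add_zero,
          LinearMap.finrank_range_of_inj ((hρinj g).comp hinj : Function.Injective φ)] at hdim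
        have := hσ.1
        have hpos : 0 < finrank ℂ W := finrank_pos
        have hle := Submodule.finrank_le (U ⊔ LinearMap.range φ)
        refine ih _ ?_ (U ⊔ LinearMap.range φ) (fun n v hv => ?_) ?_ rfl
        · omega
        · obtain ⟨x, hx, _, ⟨w, rfl⟩, rfl⟩ := Submodule.mem_sup.1 hv
          rw [map_add, hφN]
          exact Submodule.add_mem_sup (hU n x hx) ⟨_, rfl⟩
        · rw [hdim]
          exact dvd_add hd dvd_rfl
  exact key _ ⊥ (fun n v hv => by simp_all) (by simp) rfl

/-- The sum over `G ⧸ N` of the conjugates of an operator commuting with `N` is a scalar. -/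
theorem sum_quotient_conj [Finite G] [FiniteDimensional ℂ V]
    (hρ : IsIrreducibleRep ρ) [Fintype (G ⧸ N)] (T : V →ₗ[ℂ] V)
    (hT : ∀ (n : N) v, T (ρ n v) = ρ n (T v)) (v : V) :
    ∑ q : G ⧸ N, ρ q.out (T (ρ q.out⁻¹ v)) =
      ((N.index : ℂ) * LinearMap.trace ℂ V T / finrank ℂ V) • v := by
  let F : G → V →ₗ[ℂ] V := fun g => ρ g ∘ₗ T ∘ₗ ρ g⁻¹
  have hF (g : G) (n : N) : F (g * n) = F g := LinearMap.ext fun v => by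
    simp only [F, LinearMap.comp_apply, map_mul, mul_inv_rev, Module.End.mul_apply]
    rw [← InvMemClass.coe_inv, hT, ← Module.End.mul_apply (ρ n), ← map_mul]
    simp
  have hFmk (g : G) : F (g : G ⧸ N).out = F g := by
    obtain ⟨n, hn⟩ := QuotientGroup.mk_out_eq_mul N g
    rw [hn, hF]
  let S : V →ₗ[ℂ] V := ∑ q : G ⧸ N, F q.out
  obtain ⟨c, hc⟩ := hρ.exists_eq_smul_id S fun g v => by
    simp only [S, LinearMap.sum_apply, map_sum]
    refine (Fintype.sum_equiv (MulAction.toPerm g) _ _ fun q => ?_).symm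
    induction q using QuotientGroup.induction_on with
    | H x =>
      rw [MulAction.toPerm_apply, MulAction.Quotient.smul_coe, hFmk, hFmk]
      simp [F]
  have htrace (g : G) : LinearMap.trace ℂ V (F g) = LinearMap.trace ℂ V T := by
    change LinearMap.trace ℂ V (ρ g * (T * ρ g⁻¹)) = _
    rw [LinearMap.trace_mul_comm, mul_assoc, ← map_mul]
    simp
  have hS : S = c • LinearMap.id := LinearMap.ext hc
  have htr := congrArg (LinearMap.trace ℂ V) hS
  have := hρ.1
  have hpos : (finrank ℂ V : ℂ) ≠ 0 := by exact_mod_cast (finrank_pos (R := ℂ) (M := V)).ne'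
  simp only [S, map_sum, htrace, map_smul, LinearMap.trace_id, Finset.sum_const,
    Finset.card_univ, smul_eq_mul, nsmul_eq_mul, ← Nat.card_eq_fintype_card] at htr
  rw [Subgroup.index, htr, mul_div_cancel_right₀ _ hpos, ← hc]
  simp [S, F]

end IsIrreducibleRep

/-- Pairs of a group element `g` and an automorphism of determinant one carrying `σ` to its
conjugate by `g`. -/
def conjIntertwiners {G W : Type*} [Group G] {N : Subgroup G} [N.Normal] [AddCommGroup W]
    [Module ℂ W] (σ : Representation ℂ N W) : Subgroup (G × (W ≃ₗ[ℂ] W)) where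
  carrier := {p | LinearEquiv.det p.2 = 1 ∧
    ∀ n w, p.2 (σ n w) = σ (MulAut.conjNormal p.1 n) (p.2 w)}
  one_mem' := ⟨by simp, by simp⟩
  mul_mem' := by
    rintro p q ⟨hp, hp'⟩ ⟨hq, hq'⟩
    exact ⟨by simp [hp, hq], fun n w => by simp [hp', hq']⟩
  inv_mem' := by
    rintro p ⟨hp, hp'⟩
    refine ⟨by simp [hp], fun n w => p.2.injective ?_⟩
    rw [hp']
    change (p.2 * p.2⁻¹) (σ n w) = σ (MulAut.conjNormal p.1 (MulAut.conjNormal p.1⁻¹ n))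
      ((p.2 * p.2⁻¹) w)
    rw [← MulAut.mul_apply, ← map_mul]
    simp

section Intertwiners

variable {G V W : Type*} [Group G] {N : Subgroup G} [N.Normal] [AddCommGroup V] [Module ℂ V]
  [AddCommGroup W] [Module ℂ W] {ρ : Representation ℂ G V} {σ : Representation ℂ N W}
  {f : W →ₗ[ℂ] V} {φ : V →ₗ[ℂ] W}

namespace IsIrreducibleRep

/-- There are only finitely many such pairs, by Schur's lemma. -/
theorem finite_conjIntertwiners [Finite G] [FiniteDimensional ℂ W] (hσ : IsIrreducibleRep σ) :
    Finite (conjIntertwiners σ) := by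
  have := hσ.1
  have hpos : 0 < finrank ℂ W := finrank_pos
  let π : conjIntertwiners σ → G := fun p => p.1.1
  refine Set.finite_univ_iff.1 ((Set.finite_univ (α := G)).preimage' (f := π) fun g _ => ?_)
  rcases (π ⁻¹' {g}).eq_empty_or_nonempty with h | ⟨p, hp⟩
  · simp [h]
  have hroots : {z : ℂ | z ^ finrank ℂ W = 1}.Finite := by
    refine (Polynomial.nthRootsFinset (finrank ℂ W) (1 : ℂ)).finite_toSet.subset fun z hz => ?_
    simpa [Polynomial.mem_nthRootsFinset hpos] using hz
  have hscalar (q : π ⁻¹' {g}) : ∃ z : ℂ, z ^ finrank ℂ W = 1 ∧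
      ∀ w, (p⁻¹ * q.1).1.2 w = z • w := by
    have hr1 : (p⁻¹ * q.1).1.1 = 1 := by
      have hq : q.1.1.1 = g := q.2
      have hp : p.1.1 = g := hp
      simp [hp, hq]
    obtain ⟨hdet, hcomm⟩ := (p⁻¹ * q.1).2
    obtain ⟨z, hz⟩ := hσ.exists_eq_smul_id ((p⁻¹ * q.1).1.2 : W →ₗ[ℂ] W) fun n w => by
      rw [hr1, map_one] at hcomm
      exact hcomm n w
    refine ⟨z, ?_, hz⟩
    have h1 : (((p⁻¹ * q.1).1.2 : W ≃ₗ[ℂ] W) : W →ₗ[ℂ] W) = z • LinearMap.id :=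
      LinearMap.ext hz
    have h2 := congrArg Units.val hdet
    rw [LinearEquiv.coe_det, h1, LinearMap.det_smul] at h2
    simpa using h2
  choose z hz1 hz2 using hscalar
  have := hroots.to_subtype
  refine Set.finite_coe_iff.1 <| Finite.of_injective (β := {z : ℂ | z ^ finrank ℂ W = 1})
    (fun q : π ⁻¹' {g} => ⟨z q, hz1 q⟩) fun q r hqr => ?_
  have hqr' : z q = z r := congrArg Subtype.val hqr
  have h : (p⁻¹ * q.1).1.2 = (p⁻¹ * r.1).1.2 := LinearEquiv.ext fun w => by
    rw [hz2, hz2, hqr']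
  refine Subtype.ext (Subtype.ext (Prod.ext ?_ ?_))
  · exact (q.2 : q.1.1.1 = g).trans (r.2 : r.1.1.1 = g).symm
  · simpa using h

/-- A nonzero map intertwining `σ` with its conjugate by `g` is proportional to an automorphism of
determinant one. -/
theorem exists_mem_conjIntertwiners [FiniteDimensional ℂ W] (hσ : IsIrreducibleRep σ) {g : G}
    {A : W →ₗ[ℂ] W} (hA0 : A ≠ 0)
    (hA : ∀ n w, A (σ n w) = σ (MulAut.conjNormal g n) (A w)) :
    ∃ κ : conjIntertwiners σ, κ.1.1 = g := by
  have := hσ.1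
  have hpos : 0 < finrank ℂ W := finrank_pos
  have hinj : Function.Injective A :=
    hσ.injective_of_ker_invariant hA0 fun n w hw => by rw [hA, hw, map_zero]
  let e := LinearEquiv.ofInjectiveEndo A hinj
  obtain ⟨z, hz⟩ := IsAlgClosed.exists_pow_nat_eq ((LinearEquiv.det e)⁻¹ : ℂˣ).val hpos
  have hz0 : z ≠ 0 := by
    rintro rfl
    rw [zero_pow hpos.ne'] at hz
    exact Units.ne_zero _ hz.symm
  refine ⟨⟨(g, LinearEquiv.smulOfNeZero ℂ W z hz0 * e), ?_, fun n w => ?_⟩, rfl⟩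
  · refine Units.ext ?_
    have h1 : ((LinearEquiv.smulOfNeZero ℂ W z hz0 : W ≃ₗ[ℂ] W) : W →ₗ[ℂ] W) =
      z • LinearMap.id := LinearMap.ext fun _ => rfl
    rw [map_mul, Units.val_mul, LinearEquiv.coe_det, h1, LinearMap.det_smul, hz,
      LinearMap.det_id, mul_one, ← Units.val_mul, inv_mul_cancel]
  · change z • A (σ n w) = σ (MulAut.conjNormal g n) (z • A w)
    rw [hA, map_smul]

end IsIrreducibleRep

/-- The translate of an intertwining map by a pair in `conjIntertwiners`. -/
def translateIntertwiner (ρ : Representation ℂ G V) (f : W →ₗ[ℂ] V) (p : G × (W ≃ₗ[ℂ] W)) :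
    W →ₗ[ℂ] V :=
  ρ p.1 ∘ₗ f ∘ₗ ((p⁻¹).2 : W →ₗ[ℂ] W)

theorem translateIntertwiner_equivariant (hf : ∀ (n : N) (w : W), f (σ n w) = ρ n (f w))
    (p : conjIntertwiners σ) (n : N) (w : W) :
    translateIntertwiner ρ f p (σ n w) = ρ n (translateIntertwiner ρ f p w) := by
  have h := (p⁻¹).2.2 n w
  simp only [translateIntertwiner, LinearMap.comp_apply, LinearEquiv.coe_coe]
  rw [InvMemClass.coe_inv] at h
  rw [h, hf, ← Module.End.mul_apply, ← Module.End.mul_apply, ← map_mul, ← map_mul]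
  congr 2
  simp [mul_assoc]

theorem translateIntertwiner_mul_apply (p q : G × (W ≃ₗ[ℂ] W)) (w : W) :
    translateIntertwiner ρ f (p * q) (p.2 w) = ρ p.1 (translateIntertwiner ρ f q w) := by
  simp [translateIntertwiner]

/-- The index of a normal subgroup times the ratio of the degrees is an algebraic integer. -/
theorem IsIrreducibleRep.isIntegral_index_mul_finrank_div [Finite G] [FiniteDimensional ℂ V]
    [FiniteDimensional ℂ W] (hρ : IsIrreducibleRep ρ) (hσ : IsIrreducibleRep σ)
    (hf0 : f ≠ 0) (hf : ∀ (n : N) (w : W), f (σ n w) = ρ n (f w)) :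
    IsIntegral ℤ ((N.index : ℂ) * finrank ℂ W / finrank ℂ V) := by
  classical
  have := Fintype.ofFinite (G ⧸ N)
  have := hσ.1
  have := hσ.finite_conjIntertwiners
  obtain ⟨φ, c₀, hc₀, hφ, hφf⟩ := hσ.exists_equivariant_comp_eq_smul hf0 hf
  let x : conjIntertwiners σ → W →ₗ[ℂ] V := fun p => translateIntertwiner ρ f p
  have hx (p : conjIntertwiners σ) (n : N) (w : W) : x p (σ n w) = ρ n (x p w) :=
    translateIntertwiner_equivariant hf p n w
  have hscalar (p : conjIntertwiners σ) : ∃ a : ℂ, ∀ w, φ (x p w) = a • w :=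
    hσ.exists_eq_smul_id (φ ∘ₗ x p) fun n w => by simp [hx, hφ]
  choose a ha using hscalar
  have hact (κ p : conjIntertwiners σ) (w : W) :
      φ (ρ κ.1.1 (x p w)) = a (κ * p) • κ.1.2 w := by
    rw [← ha]
    exact congrArg φ (translateIntertwiner_mul_apply κ.1 p.1 w).symm
  let P : Submodule ℤ ℂ := Submodule.span ℤ
    (Set.range fun r : conjIntertwiners σ × conjIntertwiners σ => a r.1 * a r.2)
  have hterm (p q : conjIntertwiners σ) (g : G) :
      ∃ b ∈ P, ∀ w, φ (ρ g (x p (φ (ρ g⁻¹ (x q w))))) = b • w := by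
    by_cases hA : φ ∘ₗ ρ g ∘ₗ x p = 0
    · exact ⟨0, zero_mem _, fun w => by simpa using LinearMap.congr_fun hA _⟩
    · obtain ⟨κ, rfl⟩ := hσ.exists_mem_conjIntertwiners (g := g) hA fun n w => by
        simp only [LinearMap.comp_apply, hx, ← hφ]
        simp only [← Module.End.mul_apply, ← map_mul]
        congr 2
        simp
      refine ⟨a (κ * p) * a (κ⁻¹ * q), Submodule.subset_span ⟨(_, _), rfl⟩, fun w => ?_⟩
      have h := hact κ⁻¹ q w
      simp only [InvMemClass.coe_inv, Prod.fst_inv, Prod.snd_inv] at h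
      rw [h, map_smul, map_smul, map_smul, hact, smul_smul, mul_comm]
      simp
  refine isIntegral_of_smul_mem_submodule P ?_ ?_ _ ?_
  · have ha1 : a 1 = c₀ := by
      obtain ⟨w, hw⟩ := exists_ne (0 : W)
      refine smul_left_injective ℂ hw ?_
      change a 1 • w = c₀ • w
      rw [← ha, ← hφf]
      simp [x, translateIntertwiner]
    rw [Submodule.ne_bot_iff]
    exact ⟨a 1 * a 1, Submodule.subset_span ⟨(1, 1), rfl⟩, by simp [ha1, hc₀]⟩
  · exact Submodule.fg_span (Set.finite_range _)
  · intro y hy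
    induction hy using Submodule.span_induction with
    | zero => simp
    | add y z _ _ hy hz => rw [smul_add]; exact add_mem hy hz
    | smul m y _ hy => rw [smul_comm]; exact Submodule.smul_mem _ m hy
    | mem y hy =>
      obtain ⟨⟨p, q⟩, rfl⟩ := hy
      choose b hbP hb using hterm p q
      obtain ⟨w, hw⟩ := exists_ne (0 : W)
      have htrace : LinearMap.trace ℂ V (x p ∘ₗ φ) = a p * finrank ℂ W := by
        rw [LinearMap.trace_comp_comm',
          show φ ∘ₗ x p = a p • LinearMap.id from LinearMap.ext (ha p)]
        simp
      have hsum := congrArg φ (hρ.sum_quotient_conj (N := N) (x p ∘ₗ φ)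
        (fun n v => by simp [hx, hφ]) (x q w))
      simp only [map_sum, LinearMap.comp_apply, hb, map_smul, ha, htrace, smul_smul,
        ← Finset.sum_smul] at hsum
      have hsum' := smul_left_injective ℂ hw hsum
      have hmem : ∑ r : G ⧸ N, b r.out ∈ P := sum_mem fun r _ => hbP _
      rw [hsum'] at hmem
      convert hmem using 1
      simp only [smul_eq_mul]
      ring

end Intertwiners

theorem stmt_9 (G : Type*) [Group G] [Finite G] (N : Subgroup G) [N.Normal]
    (V W : Type*) [AddCommGroup V] [Module ℂ V] [FiniteDimensional ℂ V]
    [AddCommGroup W] [Module ℂ W] [FiniteDimensional ℂ W]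
    (ρ : Representation ℂ G V) (σ : Representation ℂ ↥N W)
    (hρ : IsIrreducibleRep ρ) (hσ : IsIrreducibleRep σ)
    -- θ is an irreducible constituent of the restriction of χ to N:
    (f : W →ₗ[ℂ] V) (hf0 : f ≠ 0)
    (hfequiv : ∀ (n : ↥N) (w : W), f (σ n w) = ρ (↑n) (f w)) :
    Module.finrank ℂ W ∣ Module.finrank ℂ V ∧
      Module.finrank ℂ V / Module.finrank ℂ W ∣ N.index := by
  have hd := hρ.finrank_dvd_finrank hσ hf0 hfequiv
  refine ⟨hd, ?_⟩
  have hint := hρ.isIntegral_index_mul_finrank_div hσ hf0 hfequiv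
  obtain ⟨m, hm⟩ := hd
  have := hρ.1
  have := hσ.1
  have hV : 0 < finrank ℂ V := finrank_pos
  have hW : 0 < finrank ℂ W := finrank_pos
  have hm0 : (m : ℚ) ≠ 0 := by
    intro h
    simp_all
  rw [hm, Nat.mul_div_cancel_left _ hW]
  have hratio : (N.index : ℂ) * finrank ℂ W / finrank ℂ V =
      algebraMap ℚ ℂ ((N.index : ℚ) / m) := by
    have hW' : (finrank ℂ W : ℂ) ≠ 0 := by exact_mod_cast hW.ne'
    have hm0' : (m : ℂ) ≠ 0 := by exact_mod_cast hm0
    rw [hm]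
    simp only [Nat.cast_mul, map_div₀, map_natCast]
    field_simp
  rw [hratio, isIntegral_algebraMap_iff (algebraMap ℚ ℂ).injective] at hint
  obtain ⟨k, hk⟩ := IsIntegrallyClosed.isIntegral_iff.1 hint
  rw [eq_div_iff hm0] at hk
  refine Int.natCast_dvd_natCast.1 ⟨k, ?_⟩
  have : (k : ℚ) * m = N.index := hk
  rw [mul_comm]
  exact_mod_cast this.symm
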